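/- arXiv:1609.00776 — 12 statements merged into one kernel-verified Lean document; each statement's English description precedes it below -/
import Mathlib

section
/- Let q0, q1, q2 be real parameters and let λ ≠ 0. If the smooth function u : ℝ × ℝ → ℝ satisfies u_t = q0·u·u_xxxxx + q1·u_x·u_xxxx + q2·u_xx·u_xxx, then v(x,t) := λ⁵·u(x/λ, t) satisfies the same equation. (This is the finite form of the additional symmetry X₄ = x∂_x + 5u∂_u admitted in the case p1 = p3 = 0 of the classification.) -/
/-- `pdx u n x t` is the `n`-th partial derivative of `u` with respect to the
first (space) variable, evaluated at `(x, t)`. -/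
noncomputable def pdx (u : ℝ → ℝ → ℝ) (n : ℕ) (x t : ℝ) : ℝ :=
  iteratedDeriv n (fun y => u y t) x

/-- `pdt u x t` is the partial derivative of `u` with respect to the
second (time) variable, evaluated at `(x, t)`. -/
noncomputable def pdt (u : ℝ → ℝ → ℝ) (x t : ℝ) : ℝ :=
  deriv (fun s => u x s) t

/-- `u` satisfies the Case-1 PDE `u_t = q0*u*u_5x + q1*u_x*u_4x + q2*u_2x*u_3x`. -/
def SatCase1 (q0 q1 q2 : ℝ) (u : ℝ → ℝ → ℝ) : Prop :=
  ∀ x t : ℝ,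
    pdt u x t =
      q0 * u x t * pdx u 5 x t
      + q1 * pdx u 1 x t * pdx u 4 x t
      + q2 * pdx u 2 x t * pdx u 3 x t

theorem stmt_4 (q0 q1 q2 lam : ℝ) (hlam : lam ≠ 0)
    (u : ℝ → ℝ → ℝ) (hu : ContDiff ℝ (⊤ : ℕ∞) (Function.uncurry u))
    (hpde : SatCase1 q0 q1 q2 u) :
    SatCase1 q0 q1 q2 (fun x t => lam ^ 5 * u (x / lam) t) := by
  have hs : ∀ t, ContDiff ℝ (⊤ : ℕ∞) (fun y => u y t) := fun t =>
    hu.comp (contDiff_id.prodMk contDiff_const)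
  have key : ∀ n x t, pdx (fun x t => lam ^ 5 * u (x / lam) t) n x t
      = lam ^ 5 * (lam⁻¹ ^ n * pdx u n (x / lam) t) := by
    intro n x t
    have hn : ContDiff ℝ n (fun y => u y t) := (hs t).of_le (by exact_mod_cast le_top)
    have h := congrFun (iteratedDeriv_comp_const_mul hn lam⁻¹) x
    have e : (fun y => lam ^ 5 * u (y / lam) t)
        = fun y => lam ^ 5 * (fun z => u (lam⁻¹ * z) t) y := by
      funext y
      simp only [div_eq_inv_mul]
    unfold pdx
    rw [e, iteratedDeriv_const_mul_field, h, div_eq_inv_mul]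
  intro x t
  have ht : pdt (fun x t => lam ^ 5 * u (x / lam) t) x t = lam ^ 5 * pdt u (x / lam) t := by
    unfold pdt
    exact deriv_const_mul_field _
  rw [ht, hpde, key, key, key, key, key]
  field_simp
end

section
/- Let p1 ≠ 0, q1, q2 be real parameters and let ε ∈ ℝ. If the smooth function u : ℝ × ℝ → ℝ satisfies u_t = p1·∂_x(u²) + q1·u_x·u_xxxx + q2·u_xx·u_xxx, then v(x,t) := u(x − 2·p1·ε·t, t) − ε satisfies the same equation. (This is the finite form of the Galilean-type symmetry X₄ = 2p1·t∂_x − ∂_u admitted in the case p3 = q0 = 0 of the classification.) -/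
/-- `u` satisfies the Case-2 PDE `u_t = p1*(u^2)_x + q1*u_x*u_4x + q2*u_2x*u_3x`. -/
def SatCase2 (p1 q1 q2 : ℝ) (u : ℝ → ℝ → ℝ) : Prop :=
  ∀ x t : ℝ,
    pdt u x t =
      p1 * deriv (fun y => (u y t) ^ 2) x
      + q1 * pdx u 1 x t * pdx u 4 x t
      + q2 * pdx u 2 x t * pdx u 3 x t

theorem pdx_shift_aux (u : ℝ → ℝ → ℝ) (c e t x : ℝ) (n : ℕ) :
    iteratedDeriv (n + 1) (fun y => u (y - c) t - e) x
      = iteratedDeriv (n + 1) (fun y => u y t) (x - c) := by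
  have h1 : deriv (fun y => u (y - c) t - e) = fun y => deriv (fun z => u z t) (y - c) := by
    funext y
    rw [deriv_sub_const_fun]
    exact deriv_comp_sub_const (f := fun z => u z t) (a := c) (x := y)
  rw [iteratedDeriv_succ', iteratedDeriv_succ', h1]
  exact congrFun (iteratedDeriv_comp_sub_const n (deriv fun z => u z t) c) x

theorem stmt_5 (p1 q1 q2 ε : ℝ) (hp1 : p1 ≠ 0)
    (u : ℝ → ℝ → ℝ) (hu : ContDiff ℝ (⊤ : ℕ∞) (Function.uncurry u))
    (hpde : SatCase2 p1 q1 q2 u) :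
    SatCase2 p1 q1 q2 (fun x t => u (x - 2 * p1 * ε * t) t - ε) := by
  intro x t
  have hd : Differentiable ℝ (Function.uncurry u) := hu.differentiable (by simp)
  have H := hpde (x - 2 * p1 * ε * t) t
  set c := 2 * p1 * ε * t with hc
  have hF := (hd (x - c, t)).hasFDerivAt
  set L := fderiv ℝ (Function.uncurry u) (x - c, t) with hL
  have hx : HasDerivAt (fun y => u y t) (L (1, 0)) (x - c) := by
    have h := hF.comp_hasDerivAt (x - c)
      ((hasDerivAt_id (x - c)).prodMk (hasDerivAt_const (x - c) t))
    exact h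
  have ht : HasDerivAt (fun s => u (x - c) s) (L (0, 1)) t := by
    have h := hF.comp_hasDerivAt t
      ((hasDerivAt_const t (x - c)).prodMk (hasDerivAt_id t))
    exact h
  have hv : HasDerivAt (fun s => u (x - 2 * p1 * ε * s) s - ε)
      (L (-(2 * p1 * ε), 1)) t := by
    have h0 : HasDerivAt (fun s : ℝ => x - 2 * p1 * ε * s) (-(2 * p1 * ε)) t := by
      simpa using ((hasDerivAt_id t).const_mul (2 * p1 * ε)).const_sub x
    have h := hF.comp_hasDerivAt_of_eq t (h0.prodMk (hasDerivAt_id t)) rfl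
    exact h.sub_const ε
  have hLin : L (-(2 * p1 * ε), 1) = -(2 * p1 * ε) * L (1, 0) + L (0, 1) := by
    have : ((-(2 * p1 * ε), 1) : ℝ × ℝ) = (-(2 * p1 * ε)) • ((1, 0) : ℝ × ℝ) + (0, 1) := by
      simp
    rw [this, map_add, map_smul, smul_eq_mul]
  have hvx : HasDerivAt (fun y => u (y - c) t - ε) (L (1, 0)) x :=
    (hx.comp_sub_const x c).sub_const ε
  have hsq := (hx.fun_pow 2).deriv
  have hvsq := (hvx.fun_pow 2).deriv
  unfold pdt pdx at H ⊢
  simp only [← hc]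
  rw [hv.deriv, hvsq, hLin, pdx_shift_aux u c ε t x 0, pdx_shift_aux u c ε t x 1,
    pdx_shift_aux u c ε t x 2, pdx_shift_aux u c ε t x 3]
  rw [ht.deriv, hsq] at H
  rw [H]
  norm_num
  ring
end

section
/- Let p3 ≠ 0 and β be real parameters and let λ ≠ 0. If the smooth function u : ℝ × ℝ → ℝ satisfies the third-order PDE u_t = p3·∂_x(u·u_xx + β·u_x²), then v(x,t) := λ³·u(x/λ, t) satisfies the same equation. (This is the finite form of the additional symmetry X₄ = x∂_x + 3u∂_u admitted in the third-order case, which contains the Rosenau–Hyman K(2,2) equation.) -/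
/-- `u` satisfies the third-order Case-3 PDE `u_t = p3*(u*u_xx + β*u_x^2)_x`. -/
def SatCase3 (p3 β : ℝ) (u : ℝ → ℝ → ℝ) : Prop :=
  ∀ x t : ℝ,
    pdt u x t = p3 * deriv (fun y => u y t * pdx u 2 y t + β * (pdx u 1 y t) ^ 2) x

theorem deriv_scale_aux (c lam : ℝ) (f : ℝ → ℝ) (x : ℝ) :
    deriv (fun y => c * f (y / lam)) x = c / lam * deriv f (x / lam) := by
  have h : (fun y => c * f (y / lam)) = fun y => c * (fun z => f (lam⁻¹ * z)) y := by
    funext y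
    simp only [div_eq_inv_mul]
  rw [h, deriv_const_mul_field, deriv_comp_mul_left]
  simp only [smul_eq_mul, div_eq_inv_mul]
  ring

theorem stmt_6 (p3 β lam : ℝ) (hp3 : p3 ≠ 0) (hlam : lam ≠ 0)
    (u : ℝ → ℝ → ℝ) (hu : ContDiff ℝ (⊤ : ℕ∞) (Function.uncurry u))
    (hpde : SatCase3 p3 β u) :
    SatCase3 p3 β (fun x t => lam ^ 3 * u (x / lam) t) := by
  intro x t
  have h1 : ∀ y, pdx (fun x t => lam ^ 3 * u (x / lam) t) 1 y t
      = lam ^ 2 * pdx u 1 (y / lam) t := by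
    intro y
    simp only [pdx, iteratedDeriv_one]
    rw [deriv_scale_aux (lam ^ 3) lam (fun z => u z t) y]
    congr 1
    field_simp
  have h2 : ∀ y, pdx (fun x t => lam ^ 3 * u (x / lam) t) 2 y t
      = lam * pdx u 2 (y / lam) t := by
    intro y
    have e : ∀ (w : ℝ → ℝ → ℝ) (z : ℝ), pdx w 2 z t = deriv (fun a => pdx w 1 a t) z := by
      intro w z
      simp only [pdx, iteratedDeriv_succ, iteratedDeriv_zero]
    rw [e, e, funext h1, deriv_scale_aux (lam ^ 2) lam (fun z => pdx u 1 z t) y]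
    congr 1
    field_simp
  have h3 : (fun y => (fun x t => lam ^ 3 * u (x / lam) t) y t
        * pdx (fun x t => lam ^ 3 * u (x / lam) t) 2 y t
        + β * (pdx (fun x t => lam ^ 3 * u (x / lam) t) 1 y t) ^ 2)
      = fun y => lam ^ 4 *
        (fun z => u z t * pdx u 2 z t + β * (pdx u 1 z t) ^ 2) (y / lam) := by
    funext y
    rw [h1, h2]
    ring
  have h4 : pdt (fun x t => lam ^ 3 * u (x / lam) t) x t = lam ^ 3 * pdt u (x / lam) t := by
    simp only [pdt]
    rw [deriv_const_mul_field]
  rw [h3, h4, deriv_scale_aux (lam ^ 4) lam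
    (fun z => u z t * pdx u 2 z t + β * (pdx u 1 z t) ^ 2) x, hpde (x / lam) t]
  field_simp
end

section
/- Let q1 ≠ 0 and q2 be real parameters, let λ ≠ 0 and c ∈ ℝ. If the smooth function u : ℝ × ℝ → ℝ satisfies u_t = q1·u_x·u_xxxx + q2·u_xx·u_xxx, then both v(x,t) := u(λ·x, λ⁵·t) and w(x,t) := u(x,t) + c satisfy the same equation. (These are the finite forms of the additional symmetries X₄ = ∂_u and X₅ = x∂_x + 5t∂_t admitted in Case 4 of the group classification.) -/
/-- `u` satisfies the Case-4 PDE `u_t = q1*u_x*u_4x + q2*u_2x*u_3x`. -/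
def SatCase4 (q1 q2 : ℝ) (u : ℝ → ℝ → ℝ) : Prop :=
  ∀ x t : ℝ,
    pdt u x t = q1 * pdx u 1 x t * pdx u 4 x t + q2 * pdx u 2 x t * pdx u 3 x t

theorem pdx_scale (u : ℝ → ℝ → ℝ) (hu : ContDiff ℝ (⊤ : ℕ∞) (Function.uncurry u))
    (a b : ℝ) (n : ℕ) (x t : ℝ) :
    pdx (fun x t => u (a * x) (b * t)) n x t = a ^ n * pdx u n (a * x) (b * t) := by
  have h : ContDiff ℝ (⊤ : ℕ∞) (fun y => u y (b * t)) :=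
    hu.comp (contDiff_id.prodMk contDiff_const)
  have h' : ContDiff ℝ n (fun y => u y (b * t)) := h.of_le (by exact_mod_cast le_top)
  exact congrFun (iteratedDeriv_comp_const_mul h' a) x

theorem pdx_add_const (u : ℝ → ℝ → ℝ) (c : ℝ) (n : ℕ) (x t : ℝ) :
    pdx (fun x t => u x t + c) (n + 1) x t = pdx u (n + 1) x t := by
  unfold pdx
  rw [iteratedDeriv_succ', iteratedDeriv_succ']
  congr 1
  funext y
  exact deriv_add_const c

theorem stmt_7 (q1 q2 lam c : ℝ) (hq1 : q1 ≠ 0) (hlam : lam ≠ 0)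
    (u : ℝ → ℝ → ℝ) (hu : ContDiff ℝ (⊤ : ℕ∞) (Function.uncurry u))
    (hpde : SatCase4 q1 q2 u) :
    SatCase4 q1 q2 (fun x t => u (lam * x) (lam ^ 5 * t)) ∧
    SatCase4 q1 q2 (fun x t => u x t + c) := by
  constructor
  · intro x t
    have ht : pdt (fun x t => u (lam * x) (lam ^ 5 * t)) x t
        = lam ^ 5 * pdt u (lam * x) (lam ^ 5 * t) :=
      deriv_comp_mul_left (lam ^ 5) (fun s => u (lam * x) s) t
    simp only [pdx_scale u hu]
    rw [ht, hpde]
    ring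
  · intro x t
    have ht : pdt (fun x t => u x t + c) x t = pdt u x t := deriv_add_const c
    rw [ht, pdx_add_const u c 0, pdx_add_const u c 1, pdx_add_const u c 2, pdx_add_const u c 3]
    exact hpde x t
end

section
/- Let p3 and q2 be real parameters with q2 ≠ 0 and κ := p3/q2 > 0, and let a, b ∈ ℝ. If the smooth function u : ℝ × ℝ → ℝ satisfies u_t = (p3²/(2q2))·∂_x(u²) + p3·∂_x(u·u_xx) + q2·u_xx·u_xxx, then v(x,t) := u(x,t) + a·cos(√κ·x) + b·sin(√κ·x) satisfies the same equation. (These are the finite forms of the symmetries X₄ = cos(√κ x)∂_u and X₅ = sin(√κ x)∂_u admitted in Case 5a of the group classification.) -/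
/-- `u` satisfies the Case-5 PDE
`u_t = (p3^2/(2 q2))*(u^2)_x + p3*(u*u_xx)_x + q2*u_2x*u_3x`. -/
def SatPDE5 (p3 q2 : ℝ) (u : ℝ → ℝ → ℝ) : Prop :=
  ∀ x t : ℝ,
    pdt u x t =
      (p3 ^ 2 / (2 * q2)) * deriv (fun y => (u y t) ^ 2) x
      + p3 * deriv (fun y => u y t * pdx u 2 y t) x
      + q2 * pdx u 2 x t * pdx u 3 x t

theorem rhs_factor (p3 q2 : ℝ) (hq2 : q2 ≠ 0) (f f1 f2 f3 : ℝ → ℝ)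
    (h0 : ∀ x, HasDerivAt f (f1 x) x) (h1 : ∀ x, HasDerivAt f1 (f2 x) x)
    (h2 : ∀ x, HasDerivAt f2 (f3 x) x) (x : ℝ) :
    (p3 ^ 2 / (2 * q2)) * deriv (fun y => (f y) ^ 2) x
      + p3 * deriv (fun y => f y * iteratedDeriv 2 f y) x
      + q2 * iteratedDeriv 2 f x * iteratedDeriv 3 f x
    = q2 * (p3 / q2 * f x + f2 x) * (p3 / q2 * f1 x + f3 x) := by
  have e1 : deriv f = f1 := funext fun y => (h0 y).deriv
  have e2 : deriv f1 = f2 := funext fun y => (h1 y).deriv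
  have e3 : deriv f2 = f3 := funext fun y => (h2 y).deriv
  have i2 : iteratedDeriv 2 f = f2 := by
    rw [iteratedDeriv_succ, iteratedDeriv_one, e1, e2]
  have i3 : iteratedDeriv 3 f = f3 := by
    rw [iteratedDeriv_succ, i2, e3]
  rw [i2, i3]
  have d1 : deriv (fun y => (f y) ^ 2) x = 2 * f x * f1 x := by
    have := ((h0 x).fun_pow 2).deriv
    simpa using this
  have d2 : deriv (fun y => f y * f2 y) x = f1 x * f2 x + f x * f3 x :=
    ((h0 x).mul (h2 x)).deriv
  rw [d1, d2]
  field_simp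
  ring

theorem stmt_8 (p3 q2 a b : ℝ) (hq2 : q2 ≠ 0) (hκ : 0 < p3 / q2)
    (u : ℝ → ℝ → ℝ) (hu : ContDiff ℝ (⊤ : ℕ∞) (Function.uncurry u))
    (hpde : SatPDE5 p3 q2 u) :
    SatPDE5 p3 q2 (fun x t => u x t
      + a * Real.cos (Real.sqrt (p3 / q2) * x)
      + b * Real.sin (Real.sqrt (p3 / q2) * x)) := by
  intro x t
  have hf : ContDiff ℝ (⊤ : ℕ∞) (fun y => u y t) := by
    have : ContDiff ℝ (⊤ : ℕ∞) (fun y : ℝ => (y, t)) := by fun_prop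
    exact hu.comp this
  have hd : ∀ n : ℕ, ∀ y, HasDerivAt (iteratedDeriv n (fun y => u y t))
      (iteratedDeriv (n + 1) (fun y => u y t) y) y := by
    intro n y
    rw [iteratedDeriv_succ]
    exact ((hf.differentiable_iteratedDeriv n (by exact_mod_cast WithTop.coe_lt_top _)) y).hasDerivAt
  have h0 := hd 0
  have h1 := hd 1
  have h2 := hd 2
  rw [iteratedDeriv_zero] at h0
  set k := Real.sqrt (p3 / q2) with hk
  have hkk : p3 / q2 = k ^ 2 := (Real.sq_sqrt hκ.le).symm
  have hl : ∀ y, HasDerivAt (fun y : ℝ => k * y) k y := fun y => by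
    simpa using (hasDerivAt_id y).const_mul k
  have hc : ∀ A y, HasDerivAt (fun y => A * Real.cos (k * y)) (-(A * k) * Real.sin (k * y)) y := by
    intro A y
    exact ((hl y).cos.const_mul A).congr_deriv (by ring)
  have hs : ∀ A y, HasDerivAt (fun y => A * Real.sin (k * y)) ((A * k) * Real.cos (k * y)) y := by
    intro A y
    exact ((hl y).sin.const_mul A).congr_deriv (by ring)
  have key := hpde x t
  have ht : pdt (fun x t => u x t + a * Real.cos (k * x) + b * Real.sin (k * x)) x t
      = pdt u x t := by
    simp [pdt]
  rw [ht, key]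
  simp only [pdx]
  rw [rhs_factor p3 q2 hq2 _ _ _ _ h0 h1 h2 x,
    rhs_factor p3 q2 hq2 _ _ _ _
      (fun y => ((h0 y).fun_add (hc a y)).fun_add (hs b y))
      (fun y => ((h1 y).fun_add (hs _ y)).fun_add (hc _ y))
      (fun y => ((h2 y).fun_add (hc _ y)).fun_add (hs _ y)) x, hkk]
  ring
end

section
/- Let p3 and q2 be real parameters with q2 ≠ 0 and κ := p3/q2 < 0, and let a, b ∈ ℝ. If the smooth function u : ℝ × ℝ → ℝ satisfies u_t = (p3²/(2q2))·∂_x(u²) + p3·∂_x(u·u_xx) + q2·u_xx·u_xxx, then v(x,t) := u(x,t) + a·exp(√|κ|·x) + b·exp(−√|κ|·x) satisfies the same equation. (These are the finite forms of the symmetries X₄ = e^{√|κ|x}∂_u and X₅ = e^{−√|κ|x}∂_u admitted in Case 5b of the group classification.) -/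
theorem aux_deriv (f : ℝ → ℝ) (hf : Differentiable ℝ f) (a b s : ℝ) :
    deriv (fun y => f y + a * Real.exp (s * y) + b * Real.exp (-(s * y)))
      = fun y => deriv f y + (a * s) * Real.exp (s * y) + (-(b * s)) * Real.exp (-(s * y)) := by
  funext y
  have h0 : HasDerivAt (fun y : ℝ => s * y) s y := by
    simpa using (hasDerivAt_id y).const_mul s
  have h1 := ((hf y).hasDerivAt.add (h0.exp.const_mul a)).add (h0.neg.exp.const_mul b)
  refine HasDerivAt.deriv (h1.congr_deriv ?_)
  simp only [Pi.neg_apply]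
  ring

theorem aux_diff (f : ℝ → ℝ) (hf : ContDiff ℝ (⊤ : ℕ∞) f) (n : ℕ) :
    Differentiable ℝ (iteratedDeriv n f) :=
  hf.differentiable_iteratedDeriv n (by exact_mod_cast ENat.natCast_lt_top _)

theorem aux_rhs (p3 q2 : ℝ) (hq2 : q2 ≠ 0) (f : ℝ → ℝ) (hf : ContDiff ℝ (⊤ : ℕ∞) f) (x : ℝ) :
    (p3 ^ 2 / (2 * q2)) * deriv (fun y => (f y) ^ 2) x
      + p3 * deriv (fun y => f y * iteratedDeriv 2 f y) x
      + q2 * iteratedDeriv 2 f x * iteratedDeriv 3 f x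
    = q2 * (iteratedDeriv 2 f x + p3 / q2 * f x)
        * (iteratedDeriv 3 f x + p3 / q2 * deriv f x) := by
  have d0 : DifferentiableAt ℝ f x := (hf.differentiable (by simp)) x
  have d2 : DifferentiableAt ℝ (iteratedDeriv 2 f) x :=
    aux_diff f hf 2 x
  have e1 : deriv (fun y => (f y) ^ 2) x = 2 * f x * deriv f x := by
    have h := (d0.hasDerivAt.fun_pow 2).deriv
    simpa using h
  have e2 : deriv (fun y => f y * iteratedDeriv 2 f y) x
      = deriv f x * iteratedDeriv 2 f x + f x * iteratedDeriv 3 f x := by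
    rw [iteratedDeriv_succ (n := 2)]
    exact (d0.hasDerivAt.mul d2.hasDerivAt).deriv
  rw [e1, e2]
  field_simp
  ring

theorem stmt_9 (p3 q2 a b : ℝ) (hq2 : q2 ≠ 0) (hκ : p3 / q2 < 0)
    (u : ℝ → ℝ → ℝ) (hu : ContDiff ℝ (⊤ : ℕ∞) (Function.uncurry u))
    (hpde : SatPDE5 p3 q2 u) :
    SatPDE5 p3 q2 (fun x t => u x t
      + a * Real.exp (Real.sqrt |p3 / q2| * x)
      + b * Real.exp (-(Real.sqrt |p3 / q2| * x))) := by
  intro x t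
  have hs : Real.sqrt |p3 / q2| ^ 2 = -(p3 / q2) := by
    rw [Real.sq_sqrt (abs_nonneg _), abs_of_neg hκ]
  generalize Real.sqrt |p3 / q2| = s at hs ⊢
  have hp := hpde x t
  have hf : ContDiff ℝ (⊤ : ℕ∞) (fun y => u y t) :=
    hu.comp (contDiff_id.prodMk contDiff_const)
  have hg : ContDiff ℝ (⊤ : ℕ∞)
      (fun y => u y t + a * Real.exp (s * y) + b * Real.exp (-(s * y))) := by
    fun_prop
  have hL : pdt (fun x t => u x t + a * Real.exp (s * x) + b * Real.exp (-(s * x))) x t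
      = pdt u x t := by
    simp [pdt]
  rw [hL, hp]
  simp only [pdx]
  have R1 := aux_rhs p3 q2 hq2 (fun y => u y t) hf x
  have R2 := aux_rhs p3 q2 hq2 _ hg x
  refine R1.trans (Eq.trans ?_ R2.symm)
  clear R1 R2 hp hL
  have hd (n : ℕ) : Differentiable ℝ (iteratedDeriv n (fun y => u y t)) :=
    hf.differentiable_iteratedDeriv n (by exact_mod_cast ENat.natCast_lt_top _)
  have D1 := aux_deriv (fun y => u y t) (hf.differentiable (by simp)) a b s
  have D2 := aux_deriv (iteratedDeriv 1 (fun y => u y t)) (hd 1) (a * s) (-(b * s)) s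
  have D3 := aux_deriv (iteratedDeriv 2 (fun y => u y t)) (hd 2) (a * s * s) (-(-(b * s) * s)) s
  rw [← iteratedDeriv_succ] at D2 D3
  have I1 := D1
  rw [← iteratedDeriv_one, ← iteratedDeriv_one (f := fun y => u y t)] at I1
  have I2 := D2
  rw [← I1, ← iteratedDeriv_succ] at I2
  have I3 := D3
  rw [← I2, ← iteratedDeriv_succ] at I3
  simp only [Nat.reduceAdd] at I2 I3
  rw [I2, I3, D1]
  have hk : p3 / q2 = - s ^ 2 := by linarith
  rw [hk]
  ring
end

section
/- Let p3 and q2 be real parameters with q2 ≠ 0 and κ := p3/q2 > 0, and let a, b, c ∈ ℝ. Then the time-independent function u(x,t) := c + a·cos(√κ·x) + b·sin(√κ·x) is an exact solution of the PDE u_t = (p3²/(2q2))·∂_x(u²) + p3·∂_x(u·u_xx) + q2·u_xx·u_xxx (the sinusoidal stationary solutions arising from invariance under time translations in Case 5a). -/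
theorem stmt_10 (p3 q2 a b c : ℝ) (hq2 : q2 ≠ 0) (hκ : 0 < p3 / q2) :
    SatPDE5 p3 q2 (fun x _ => c
      + a * Real.cos (Real.sqrt (p3 / q2) * x)
      + b * Real.sin (Real.sqrt (p3 / q2) * x)) := by
  intro x t
  obtain ⟨k, hk⟩ : ∃ k, k = Real.sqrt (p3 / q2) := ⟨_, rfl⟩
  have hk2 : k ^ 2 = p3 / q2 := by rw [hk]; exact Real.sq_sqrt hκ.le
  have hp : p3 = k ^ 2 * q2 := by rw [hk2]; field_simp
  rw [← hk]
  have hlin : ∀ y : ℝ, HasDerivAt (fun y => k * y) k y := fun y => by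
    simpa using (hasDerivAt_id y).const_mul k
  have hg : ∀ A B C y : ℝ, HasDerivAt
      (fun y => C + A * Real.cos (k * y) + B * Real.sin (k * y))
      (0 + (k * B) * Real.cos (k * y) + (-k * A) * Real.sin (k * y)) y := by
    intro A B C y
    have h := (((hlin y).cos.const_mul A).const_add C).add ((hlin y).sin.const_mul B)
    refine h.congr_deriv ?_
    ring
  have hd : ∀ A B C : ℝ,
      deriv (fun y => C + A * Real.cos (k * y) + B * Real.sin (k * y)) =
      fun y => 0 + (k * B) * Real.cos (k * y) + (-k * A) * Real.sin (k * y) :=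
    fun A B C => funext fun y => (hg A B C y).deriv
  have h2 : ∀ y, pdx (fun x _ => c + a * Real.cos (k * x) + b * Real.sin (k * x)) 2 y t =
      0 + (k * (-k * a)) * Real.cos (k * y) + (-k * (k * b)) * Real.sin (k * y) := by
    intro y
    simp only [pdx, iteratedDeriv_succ, iteratedDeriv_zero]
    rw [hd, hd]
  have h3 : pdx (fun x _ => c + a * Real.cos (k * x) + b * Real.sin (k * x)) 3 x t =
      0 + (k * (-k * (k * b))) * Real.cos (k * x)
        + (-k * (k * (-k * a))) * Real.sin (k * x) := by
    simp only [pdx, iteratedDeriv_succ, iteratedDeriv_zero]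
    rw [hd, hd, hd]
  have e1 := ((hg a b c x).fun_pow 2).deriv
  have e2 := ((hg a b c x).fun_mul (hg (k * (-k * a)) (-k * (k * b)) 0 x)).deriv
  simp only [h2, h3, pdt, deriv_const]
  rw [e1, e2, hp]
  field_simp
  push_cast
  ring
end

section
/- Let p3 and q2 be real parameters with q2 ≠ 0 and κ := p3/q2 < 0, and let a, b, c ∈ ℝ. Then the time-independent function u(x,t) := c + a·exp(√|κ|·x) + b·exp(−√|κ|·x) is an exact solution of the PDE u_t = (p3²/(2q2))·∂_x(u²) + p3·∂_x(u·u_xx) + q2·u_xx·u_xxx (the exponential stationary solutions arising from invariance under time translations in Case 5b). -/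
theorem hasDeriv_aux (k a b c x : ℝ) :
    HasDerivAt (fun y : ℝ => c + a * Real.exp (k * y) + b * Real.exp (-(k * y)))
      (0 + (a * k) * Real.exp (k * x) + (-(b * k)) * Real.exp (-(k * x))) x := by
  have h1 : HasDerivAt (fun y : ℝ => k * y) k x := by
    simpa using (hasDerivAt_id x).const_mul k
  have h := ((h1.exp.const_mul a).const_add c).add ((h1.neg.exp).const_mul b)
  refine h.congr_deriv ?_
  simp only [Pi.neg_apply]
  ring

theorem deriv_aux (k a b c : ℝ) :
    deriv (fun y : ℝ => c + a * Real.exp (k * y) + b * Real.exp (-(k * y)))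
      = fun x => 0 + (a * k) * Real.exp (k * x) + (-(b * k)) * Real.exp (-(k * x)) :=
  funext fun x => (hasDeriv_aux k a b c x).deriv

theorem stmt_11 (p3 q2 a b c : ℝ) (hq2 : q2 ≠ 0) (hκ : p3 / q2 < 0) :
    SatPDE5 p3 q2 (fun x _ => c
      + a * Real.exp (Real.sqrt |p3 / q2| * x)
      + b * Real.exp (-(Real.sqrt |p3 / q2| * x))) := by
  have hk : Real.sqrt |p3 / q2| ^ 2 = -(p3 / q2) := by
    rw [Real.sq_sqrt (abs_nonneg _), abs_of_neg hκ]
  generalize Real.sqrt |p3 / q2| = k at hk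
  have hp : p3 = -(k ^ 2 * q2) := by
    rw [hk]
    field_simp
  intro x t
  simp only [pdt, pdx, iteratedDeriv_succ, iteratedDeriv_zero, deriv_aux, deriv_const]
  have hu := hasDeriv_aux k a b c x
  have hw := hasDeriv_aux k (a * k * k) (-(-(b * k) * k)) 0 x
  have e1 := (hu.pow 2).deriv
  have e2 := (hu.mul hw).deriv
  simp only [Pi.pow_def, Pi.mul_def] at e1 e2
  rw [e1, e2, hp]
  field_simp
  ring
end

section
/- Let p3 and q2 be real parameters with q2 ≠ 0 and κ := p3/q2 < 0, and let φ : ℝ → ℝ be smooth. The function u(x,t) := t·exp(√|κ|·x) + φ(x) satisfies the PDE u_t = (p3²/(2q2))·∂_x(u²) + p3·∂_x(u·u_xx) + q2·u_xx·u_xxx on ℝ × ℝ if and only if φ satisfies the reduced ODE (p3²/q2)·φ·φ' + p3·(φ·φ'')' + q2·φ''·φ''' = exp(√|κ|·x) on ℝ. (This is the similarity reduction corresponding to the symmetry X₄ + X₂ in Case 5b of the group classification.) -/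
theorem iteratedDeriv_of_chain (f : ℕ → ℝ → ℝ)
    (h : ∀ n x, HasDerivAt (f n) (f (n + 1) x) x) (n : ℕ) :
    iteratedDeriv n (f 0) = f n := by
  induction n with
  | zero => simp
  | succ k ih =>
    rw [iteratedDeriv_succ, ih]
    funext x
    exact (h k x).deriv

theorem stmt_16 (p3 q2 : ℝ) (hq2 : q2 ≠ 0) (hκ : p3 / q2 < 0)
    (φ : ℝ → ℝ) (hφ : ContDiff ℝ (⊤ : ℕ∞) φ) :
    SatPDE5 p3 q2 (fun x t => t * Real.exp (Real.sqrt |p3 / q2| * x) + φ x)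
    ↔
    (∀ x : ℝ,
      (p3 ^ 2 / q2) * φ x * deriv φ x
        + p3 * deriv (fun y => φ y * iteratedDeriv 2 φ y) x
        + q2 * iteratedDeriv 2 φ x * iteratedDeriv 3 φ x
      = Real.exp (Real.sqrt |p3 / q2| * x)) := by
  set a := Real.sqrt |p3 / q2| with ha
  have ha2 : a ^ 2 = -(p3 / q2) := by
    rw [ha, Real.sq_sqrt (abs_nonneg _), abs_of_neg hκ]
  have hp3 : p3 = -(a ^ 2) * q2 := by
    rw [ha2]; field_simp
  have hφd : ∀ n x, HasDerivAt (iteratedDeriv n φ) (iteratedDeriv (n + 1) φ x) x := by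
    intro n x
    rw [iteratedDeriv_succ]
    apply DifferentiableAt.hasDerivAt
    exact (hφ.differentiable_iteratedDeriv n (by exact_mod_cast WithTop.coe_lt_top n)) x
  have hE : ∀ x, HasDerivAt (fun y => Real.exp (a * y)) (a * Real.exp (a * x)) x := by
    intro x
    have h := ((hasDerivAt_id x).const_mul a).exp
    simp only [id, mul_one] at h
    rw [mul_comm]
    exact h
  let f : ℝ → ℕ → ℝ → ℝ := fun t n x => t * (a ^ n * Real.exp (a * x)) + iteratedDeriv n φ x
  have hf : ∀ t n x, HasDerivAt (f t n) (f t (n + 1) x) x := by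
    intro t n x
    have h := (((hE x).const_mul (a ^ n)).const_mul t).add (hφd n x)
    refine h.congr_deriv ?_
    simp only [f]
    ring
  have hf0 : ∀ t, (fun y => t * Real.exp (a * y) + φ y) = f t 0 := by
    intro t
    funext y
    simp [f]
  have hu : ∀ n x t, pdx (fun x t => t * Real.exp (a * x) + φ x) n x t = f t n x := by
    intro n x t
    unfold pdx
    rw [hf0 t, iteratedDeriv_of_chain (f t) (hf t) n]
  have ht : ∀ x t, pdt (fun x t => t * Real.exp (a * x) + φ x) x t = Real.exp (a * x) := by
    intro x t
    unfold pdt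
    simp
  have hsq : ∀ x t, deriv (fun y => (t * Real.exp (a * y) + φ y) ^ 2) x
      = 2 * f t 0 x * f t 1 x := by
    intro x t
    have h2 := ((hf t 0 x).pow 2).deriv
    have e : (fun y => (t * Real.exp (a * y) + φ y) ^ 2) = f t 0 ^ 2 := by
      rw [← hf0 t]; rfl
    rw [e, h2]
    simp
  have hpr : ∀ x t, deriv (fun y => (t * Real.exp (a * y) + φ y) * f t 2 y) x
      = f t 1 x * f t 2 x + f t 0 x * f t 3 x := by
    intro x t
    have h2 := ((hf t 0 x).mul (hf t 2 x)).deriv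
    have e : (fun y => (t * Real.exp (a * y) + φ y) * f t 2 y) = f t 0 * f t 2 := by
      rw [← hf0 t]; rfl
    rw [e, h2]
  have hpφ : ∀ x, deriv (fun y => φ y * iteratedDeriv 2 φ y) x
      = deriv φ x * iteratedDeriv 2 φ x + φ x * iteratedDeriv 3 φ x := by
    intro x
    have h := (hφd 0 x).mul (hφd 2 x)
    have h2 := h.deriv
    simp only [iteratedDeriv_zero, iteratedDeriv_one, zero_add] at h2
    exact h2
  have key : ∀ x t, (p3 ^ 2 / (2 * q2)) * (2 * f t 0 x * f t 1 x)
      + p3 * (f t 1 x * f t 2 x + f t 0 x * f t 3 x) + q2 * f t 2 x * f t 3 x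
      = (p3 ^ 2 / q2) * φ x * deriv φ x
        + p3 * (deriv φ x * iteratedDeriv 2 φ x + φ x * iteratedDeriv 3 φ x)
        + q2 * iteratedDeriv 2 φ x * iteratedDeriv 3 φ x := by
    intro x t
    have e1 : p3 ^ 2 / (2 * q2) = a ^ 4 * q2 / 2 := by
      rw [hp3]; field_simp
    have e2 : p3 ^ 2 / q2 = a ^ 4 * q2 := by
      rw [hp3]; field_simp
    rw [e1, e2, hp3]
    simp only [f, iteratedDeriv_zero, iteratedDeriv_one]
    ring
  unfold SatPDE5
  simp only [ht, hu, hsq, hpr, hpφ, key]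
  constructor
  · intro h x
    exact (h x 0).symm
  · intro h x t
    exact (h x).symm
end

section
/- Let p1, p3, q0 be real parameters and let u : ℝ × ℝ → ℝ be a smooth, everywhere positive function satisfying the PDE u_t = p1·∂_x(u²) + p3·∂_x(u·u_xx) + q0·∂_x(u·u_xxxx). Then u satisfies the conservation law ∂_t(u·ln u) = ∂_x[ (ln u + 1)·u·(p3·u_xx + q0·u_xxxx) + (p1/2)·(2·ln u + 1)·u² − (1/2)·u_x·(p3·u_x + 2·q0·u_xxx) + (q0/2)·u_xx² ]. (This is the logarithmic conservation law obtained from the quasi self-adjoint substitution Φ = ln u together with the scaling symmetry X₃.) -/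
theorem stmt_17 (p1 p3 q0 : ℝ)
    (u : ℝ → ℝ → ℝ) (hu : ContDiff ℝ (⊤ : ℕ∞) (Function.uncurry u))
    (hpos : ∀ x t : ℝ, 0 < u x t)
    (hpde : ∀ x t : ℝ,
      pdt u x t =
        p1 * deriv (fun y => (u y t) ^ 2) x
        + p3 * deriv (fun y => u y t * pdx u 2 y t) x
        + q0 * deriv (fun y => u y t * pdx u 4 y t) x) :
    ∀ x t : ℝ,
      deriv (fun s => u x s * Real.log (u x s)) t =
        deriv (fun y =>
          (Real.log (u y t) + 1) * u y t * (p3 * pdx u 2 y t + q0 * pdx u 4 y t)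
          + (p1 / 2) * (2 * Real.log (u y t) + 1) * (u y t) ^ 2
          - (1 / 2) * pdx u 1 y t * (p3 * pdx u 1 y t + 2 * q0 * pdx u 3 y t)
          + (q0 / 2) * (pdx u 2 y t) ^ 2) x := by
  intro x t
  have hsl : ContDiff ℝ (⊤ : ℕ∞) (fun y => u y t) :=
    hu.comp (contDiff_id.prodMk contDiff_const)
  have hst : ContDiff ℝ (⊤ : ℕ∞) (fun s => u x s) :=
    hu.comp (contDiff_const.prodMk contDiff_id)
  have hd : ∀ n : ℕ, HasDerivAt (fun y => pdx u n y t) (pdx u (n + 1) x t) x := by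
    intro n
    have h1 : Differentiable ℝ (iteratedDeriv n (fun y => u y t)) :=
      hsl.differentiable_iteratedDeriv n (by exact_mod_cast WithTop.coe_lt_top n)
    have h2 := (h1 x).hasDerivAt
    rw [← iteratedDeriv_succ] at h2
    exact h2
  have h0 : HasDerivAt (fun y => u y t) (pdx u 1 x t) x := by
    simpa [pdx] using hd 0
  have h1 := hd 1
  have h2 := hd 2
  have h3 := hd 3
  have h4 := hd 4
  norm_num at h1 h2 h3 h4
  have hne : u x t ≠ 0 := (hpos x t).ne'
  have hl := h0.log hne
  have ht : HasDerivAt (fun s => u x s) (pdt u x t) t :=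
    ((hst.differentiable (by simp)) t).hasDerivAt
  have hL := (ht.fun_mul (ht.log hne)).deriv
  have e1 := (h0.fun_pow 2).deriv
  have e2 := (h0.fun_mul h2).deriv
  have e3 := (h0.fun_mul h4).deriv
  have hp := hpde x t
  rw [e1, e2, e3] at hp
  have hR := ((((((hl.add_const 1).fun_mul h0).fun_mul
      ((h2.const_mul p3).fun_add (h4.const_mul q0))).fun_add
      ((((hl.const_mul 2).add_const 1).const_mul (p1 / 2)).fun_mul (h0.fun_pow 2))).fun_sub
      ((h1.const_mul (1 / 2)).fun_mul
        ((h1.const_mul p3).fun_add (h3.const_mul (2 * q0))))).fun_add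
      ((h2.fun_pow 2).const_mul (q0 / 2))).deriv
  rw [hL, hR, hp]
  field_simp
  push_cast
  ring
end

section
/- Let p3, q0, q2 be real parameters and let u : ℝ × ℝ → ℝ be a smooth function satisfying the PDE u_t = p3·∂_x(u·u_xx − (1/4)·u_x²) + q0·u·u_xxxxx + (3/2)·q0·u_x·u_xxxx + q2·u_xx·u_xxx (i.e. the case p1 = 0, β = −1/4, q1 = (3/2)·q0). Then u satisfies the conservation law ∂_t(u_x²) + ∂_x[ u·(p3·u_xx² − q0·u_xxx² + 2·q0·u_xx·u_xxxx) + q0·u_x·u_xx·u_xxx + ((2·q2 − q0)/3)·u_xx³ − 2·u_x·u_t ] = 0. (This is the higher-order conservation law obtained from the generalized nonlinear self-adjoint substitution Φ = u_xx together with the scaling symmetry X₃.) -/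
lemma aux_pdx (u : ℝ → ℝ → ℝ) (hu : ContDiff ℝ (⊤ : ℕ∞) (Function.uncurry u)) (n : ℕ) (x t : ℝ) :
    HasDerivAt (fun y => pdx u n y t) (pdx u (n+1) x t) x := by
  have h : ContDiff ℝ (⊤ : ℕ∞) (fun y => u y t) :=
    hu.comp (contDiff_id.prodMk contDiff_const)
  have hd : Differentiable ℝ (iteratedDeriv n (fun y => u y t)) :=
    h.differentiable_iteratedDeriv n (by exact_mod_cast WithTop.coe_lt_top n)
  unfold pdx
  rw [iteratedDeriv_succ]
  exact (hd x).hasDerivAt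

lemma aux_symm (u : ℝ → ℝ → ℝ) (hu : ContDiff ℝ (⊤ : ℕ∞) (Function.uncurry u)) (x t : ℝ) :
    ∃ m, HasDerivAt (fun s => pdx u 1 x s) m t ∧ HasDerivAt (fun y => pdt u y t) m x := by
  set U := Function.uncurry u with hU
  have hd : Differentiable ℝ U := hu.differentiable (by simp)
  have hx : ∀ x t, HasDerivAt (fun y => ((y, t) : ℝ × ℝ)) (1, 0) x := fun x t =>
    (hasDerivAt_id x).prodMk (hasDerivAt_const x t)
  have ht : ∀ x t, HasDerivAt (fun s => ((x, s) : ℝ × ℝ)) (0, 1) t := fun x t =>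
    (hasDerivAt_const t x).prodMk (hasDerivAt_id t)
  have e1 : ∀ x t, pdx u 1 x t = fderiv ℝ U (x, t) (1, 0) := fun x t => by
    unfold pdx
    rw [iteratedDeriv_one]
    exact ((hd (x, t)).hasFDerivAt.comp_hasDerivAt x (hx x t)).deriv
  have e2 : ∀ x t, pdt u x t = fderiv ℝ U (x, t) (0, 1) := fun x t =>
    ((hd (x, t)).hasFDerivAt.comp_hasDerivAt t (ht x t)).deriv
  have hd2 : Differentiable ℝ (fderiv ℝ U) :=
    (hu.fderiv_right (m := 1) (by norm_num; exact WithTop.coe_le_coe.2 le_top)).differentiable (by simp)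
  have hs := second_derivative_symmetric (fun y => (hd y).hasFDerivAt)
    (hd2 (x, t)).hasFDerivAt (0, 1) (1, 0)
  refine ⟨fderiv ℝ (fderiv ℝ U) (x, t) (0, 1) (1, 0), ?_, ?_⟩
  · simp only [e1]
    have h1 := (hd2 (x, t)).hasFDerivAt.comp_hasDerivAt t (ht x t)
    exact (ContinuousLinearMap.apply ℝ ℝ ((1, 0) : ℝ × ℝ)).hasFDerivAt.comp_hasDerivAt t h1
  · simp only [e2]
    rw [hs]
    have h1 := (hd2 (x, t)).hasFDerivAt.comp_hasDerivAt x (hx x t)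
    exact (ContinuousLinearMap.apply ℝ ℝ ((0, 1) : ℝ × ℝ)).hasFDerivAt.comp_hasDerivAt x h1

theorem stmt_18 (p3 q0 q2 : ℝ)
    (u : ℝ → ℝ → ℝ) (hu : ContDiff ℝ (⊤ : ℕ∞) (Function.uncurry u))
    (hpde : ∀ x t : ℝ,
      pdt u x t =
        p3 * deriv (fun y => u y t * pdx u 2 y t - (1 / 4) * (pdx u 1 y t) ^ 2) x
        + q0 * u x t * pdx u 5 x t
        + (3 / 2) * q0 * pdx u 1 x t * pdx u 4 x t
        + q2 * pdx u 2 x t * pdx u 3 x t) :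
    ∀ x t : ℝ,
      deriv (fun s => (pdx u 1 x s) ^ 2) t
      + deriv (fun y =>
          u y t * (p3 * (pdx u 2 y t) ^ 2 - q0 * (pdx u 3 y t) ^ 2
            + 2 * q0 * pdx u 2 y t * pdx u 4 y t)
          + q0 * pdx u 1 y t * pdx u 2 y t * pdx u 3 y t
          + ((2 * q2 - q0) / 3) * (pdx u 2 y t) ^ 3
          - 2 * pdx u 1 y t * pdt u y t) x = 0 := by
  intro x t
  obtain ⟨m, hm1, hm2⟩ := aux_symm u hu x t
  have h0 : HasDerivAt (fun y => u y t) (pdx u 1 x t) x := by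
    simpa [pdx] using aux_pdx u hu 0 x t
  have h1 := aux_pdx u hu 1 x t
  have h2 := aux_pdx u hu 2 x t
  have h3 := aux_pdx u hu 3 x t
  have h4 := aux_pdx u hu 4 x t
  norm_num only at h1 h2 h3 h4
  have hp := hpde x t
  have hA := ((h0.fun_mul h2).fun_sub ((h1.fun_pow 2).const_mul (1 / 4))).deriv
  rw [hA] at hp
  have hB := (hm1.fun_pow 2).deriv
  have hC := (((h0.fun_mul ((((h2.fun_pow 2).const_mul p3).fun_sub
      ((h3.fun_pow 2).const_mul q0)).fun_add ((h2.const_mul (2 * q0)).fun_mul h4))).fun_add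
      (((h1.const_mul q0).fun_mul h2).fun_mul h3)).fun_add
      ((h2.fun_pow 3).const_mul ((2 * q2 - q0) / 3))).fun_sub ((h1.const_mul 2).fun_mul hm2) |>.deriv
  rw [hB, hC, hp]
  push_cast
  ring
end

section
/- Let p1, p3, q0, q1 be real parameters and let u : ℝ × ℝ → ℝ be a smooth function satisfying the PDE u_t = p1·∂_x(u²) + p3·∂_x(u·u_xx + (1/2)·u_x²) + q0·u·u_xxxxx + q1·u_x·u_xxxx + 5·(q1 − 2·q0)·u_xx·u_xxx (i.e. the strictly self-adjoint case β = 1/2, q2 = 5(q1 − 2q0)). Then u satisfies the conservation law ∂_t(u²) = ∂_x[ (4·p1/3)·u³ + 2·p3·u²·u_xx + 2·q0·u²·u_xxxx + 2·(q1 − 2·q0)·u·u_x·u_xxx − 2·(q1 − 2·q0)·u_x²·u_xx + 4·(q1 − 2·q0)·u·u_xx² ]. (This conservation law, with conserved density u², corresponds to the strict self-adjointness of the equation and yields the constancy of ∫ u² dx on rapidly decaying solutions.) -/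
/-- `u` satisfies the fifth-order PDE
`u_t = p1*(u^2)_x + p3*(u*u_xx + β*u_x^2)_x + q0*u*u_5x + q1*u_x*u_4x + q2*u_2x*u_3x`. -/
def SatPDE (p1 p3 β q0 q1 q2 : ℝ) (u : ℝ → ℝ → ℝ) : Prop :=
  ∀ x t : ℝ,
    pdt u x t =
      p1 * deriv (fun y => (u y t) ^ 2) x
      + p3 * deriv (fun y => u y t * pdx u 2 y t + β * (pdx u 1 y t) ^ 2) x
      + q0 * u x t * pdx u 5 x t
      + q1 * pdx u 1 x t * pdx u 4 x t
      + q2 * pdx u 2 x t * pdx u 3 x t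

theorem stmt_19 (p1 p3 q0 q1 : ℝ)
    (u : ℝ → ℝ → ℝ) (hu : ContDiff ℝ (⊤ : ℕ∞) (Function.uncurry u))
    (hpde : SatPDE p1 p3 (1 / 2) q0 q1 (5 * (q1 - 2 * q0)) u) :
    ∀ x t : ℝ,
      deriv (fun s => (u x s) ^ 2) t =
        deriv (fun y =>
          (4 * p1 / 3) * (u y t) ^ 3
          + 2 * p3 * (u y t) ^ 2 * pdx u 2 y t
          + 2 * q0 * (u y t) ^ 2 * pdx u 4 y t
          + 2 * (q1 - 2 * q0) * u y t * pdx u 1 y t * pdx u 3 y t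
          - 2 * (q1 - 2 * q0) * (pdx u 1 y t) ^ 2 * pdx u 2 y t
          + 4 * (q1 - 2 * q0) * u y t * (pdx u 2 y t) ^ 2) x := by
  intro x t
  have hx : ContDiff ℝ (⊤ : ℕ∞) (fun y => u y t) :=
    hu.comp (contDiff_id.prodMk contDiff_const)
  have ht : ContDiff ℝ (⊤ : ℕ∞) (fun s => u x s) :=
    hu.comp (contDiff_const.prodMk contDiff_id)
  have hd : ∀ n : ℕ, HasDerivAt (fun y => pdx u n y t) (pdx u (n + 1) x t) x := by
    intro n
    have h1 : Differentiable ℝ (iteratedDeriv n (fun y => u y t)) :=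
      hx.differentiable_iteratedDeriv n (by exact_mod_cast WithTop.coe_lt_top n)
    have h2 := (h1 x).hasDerivAt
    rw [← iteratedDeriv_succ] at h2
    exact h2
  have h0 : HasDerivAt (fun y => u y t) (pdx u 1 x t) x := by
    simpa [pdx] using hd 0
  have h1 := hd 1
  have h2 := hd 2
  have h3 := hd 3
  have h4 := hd 4
  norm_num at h1 h2 h3 h4
  have hT : HasDerivAt (fun s => u x s) (pdt u x t) t :=
    (ht.differentiable (by simp) t).hasDerivAt
  have e := hpde x t
  rw [(h0.fun_pow 2).deriv, ((h0.fun_mul h2).fun_add ((h1.fun_pow 2).const_mul (1 / 2))).deriv] at e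
  rw [(hT.fun_pow 2).deriv, e]
  symm
  have A := (h0.fun_pow 3).const_mul (4 * p1 / 3)
  have B := ((h0.fun_pow 2).const_mul (2 * p3)).fun_mul h2
  have C := ((h0.fun_pow 2).const_mul (2 * q0)).fun_mul h4
  have D := ((h0.const_mul (2 * (q1 - 2 * q0))).fun_mul h1).fun_mul h3
  have E := ((h1.fun_pow 2).const_mul (2 * (q1 - 2 * q0))).fun_mul h2
  have F := (h0.const_mul (4 * (q1 - 2 * q0))).fun_mul (h2.fun_pow 2)
  rw [(((((A.fun_add B).fun_add C).fun_add D).fun_sub E).fun_add F).deriv]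
  push_cast
  ring
end
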